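/- Let R be a left GF-closed ring with l.Gwdim(R) < ∞ and let n be a positive integer. Then l.Gwdim(R) ≤ n if and only if Gfd_R(R/I) ≤ n for every finitely generated left ideal I of R. -/

import Mathlib

/-!
Background definitions for D. Bennis, "Weak Gorenstein global dimensions".

Conventions.  All rings are associative with identity.  A *left* `R`-module is a type with
`[AddCommGroup M] [Module R M]`; a *right* `R`-module is a left module over the opposite ring,
i.e. `[Module Rᵐᵒᵖ M]`.  All "right-handed" notions below are obtained by applying the
corresponding "left-handed" notion to the opposite ring `Rᵐᵒᵖ`.
-/

open MulOpposite

universe u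

section Tensor

variable (S : Type u) [Ring S]

/-- The subgroup of relations defining the tensor product `A ⊗_S M` of a right `S`-module `A`
and a left `S`-module `M` over a (possibly noncommutative) ring `S`. -/
def tensorRels (A : Type u) [AddCommGroup A] [Module Sᵐᵒᵖ A]
    (M : Type u) [AddCommGroup M] [Module S M] :
    AddSubgroup (FreeAbelianGroup (A × M)) :=
  AddSubgroup.closure
    { x | (∃ a₁ a₂ m, x = FreeAbelianGroup.of (a₁ + a₂, m) - FreeAbelianGroup.of (a₁, m) -
            FreeAbelianGroup.of (a₂, m)) ∨
          (∃ a m₁ m₂, x = FreeAbelianGroup.of (a, m₁ + m₂) - FreeAbelianGroup.of (a, m₁) -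
            FreeAbelianGroup.of (a, m₂)) ∨
          (∃ (a : A) (r : S) (m : M), x = FreeAbelianGroup.of (op r • a, m) - FreeAbelianGroup.of (a, r • m)) }

/-- The tensor product `A ⊗_S M` (an abelian group) of a right `S`-module `A` and a left
`S`-module `M` over a (possibly noncommutative) ring `S`. -/
def NTensor (A : Type u) [AddCommGroup A] [Module Sᵐᵒᵖ A]
    (M : Type u) [AddCommGroup M] [Module S M] : Type u :=
  FreeAbelianGroup (A × M) ⧸ tensorRels S A M

instance (A : Type u) [AddCommGroup A] [Module Sᵐᵒᵖ A]
    (M : Type u) [AddCommGroup M] [Module S M] : AddCommGroup (NTensor S A M) :=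
  QuotientAddGroup.Quotient.addCommGroup _

namespace NTensor

variable {S}
variable {A A' : Type u} [AddCommGroup A] [Module Sᵐᵒᵖ A] [AddCommGroup A'] [Module Sᵐᵒᵖ A']
variable {M M' : Type u} [AddCommGroup M] [Module S M] [AddCommGroup M'] [Module S M']

/-- Functoriality of `A ⊗_S −` : the map `A ⊗_S M → A ⊗_S M'` induced by a linear map
`g : M → M'` of left `S`-modules. -/
def rmap (A : Type u) [AddCommGroup A] [Module Sᵐᵒᵖ A] (g : M →ₗ[S] M') :
    NTensor S A M →+ NTensor S A M' :=
  QuotientAddGroup.map (tensorRels S A M) (tensorRels S A M') (FreeAbelianGroup.map (Prod.map id g)) (by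
    simp only [tensorRels]
    refine (AddSubgroup.closure_le _).2 ?_
    rintro x (⟨a₁, a₂, m, rfl⟩ | ⟨a, m₁, m₂, rfl⟩ | ⟨a, r, m, rfl⟩) <;>
      refine SetLike.mem_coe.2 (AddSubgroup.mem_comap.2 (AddSubgroup.subset_closure ?_)) <;>
      simp only [map_sub, map_add, map_smul, FreeAbelianGroup.map_of_apply, Prod.map_apply,
        id_eq, Set.mem_setOf_eq]
    · exact Or.inl ⟨a₁, a₂, g m, rfl⟩
    · exact Or.inr (Or.inl ⟨a, g m₁, g m₂, rfl⟩)
    · exact Or.inr (Or.inr ⟨a, r, g m, rfl⟩))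

/-- Functoriality of `− ⊗_S M` : the map `A ⊗_S M → A' ⊗_S M` induced by a linear map
`f : A → A'` of right `S`-modules. -/
def lmap (M : Type u) [AddCommGroup M] [Module S M] (f : A →ₗ[Sᵐᵒᵖ] A') :
    NTensor S A M →+ NTensor S A' M :=
  QuotientAddGroup.map (tensorRels S A M) (tensorRels S A' M) (FreeAbelianGroup.map (Prod.map f id)) (by
    simp only [tensorRels]
    refine (AddSubgroup.closure_le _).2 ?_
    rintro x (⟨a₁, a₂, m, rfl⟩ | ⟨a, m₁, m₂, rfl⟩ | ⟨a, r, m, rfl⟩) <;>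
      refine SetLike.mem_coe.2 (AddSubgroup.mem_comap.2 (AddSubgroup.subset_closure ?_)) <;>
      simp only [map_sub, map_add, map_smul, FreeAbelianGroup.map_of_apply, Prod.map_apply,
        id_eq, Set.mem_setOf_eq]
    · exact Or.inl ⟨f a₁, f a₂, m, rfl⟩
    · exact Or.inr (Or.inl ⟨f a, m₁, m₂, rfl⟩)
    · exact Or.inr (Or.inr ⟨f a, r, m, rfl⟩))

end NTensor

end Tensor

section Dims

variable (S : Type u) [Ring S]

/-- A left `S`-module `M` is *flat* if tensoring with it preserves injectivity of maps of
right `S`-modules. -/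
def IsFlatMod (M : ModuleCat.{u} S) : Prop :=
  ∀ (A B : Type u) [AddCommGroup A] [Module Sᵐᵒᵖ A] [AddCommGroup B] [Module Sᵐᵒᵖ B]
    (f : A →ₗ[Sᵐᵒᵖ] B), Function.Injective f →
      Function.Injective (NTensor.lmap (↥M) f)

/-- A left `S`-module `M` is *Gorenstein flat* if there is an exact sequence
`⋯ → F (-1) → F 0 → F 1 → ⋯` of flat left `S`-modules with `M ≅ Im (F 0 → F 1)` which stays
exact after applying `I ⊗_S −` for every injective right `S`-module `I`
(a *complete flat resolution*). -/
def IsGorensteinFlat (M : ModuleCat.{u} S) : Prop :=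
  ∃ (F : ℤ → ModuleCat.{u} S) (d : ∀ n : ℤ, ↥(F n) →ₗ[S] ↥(F (n + 1))),
    (∀ n, IsFlatMod S (F n)) ∧
    (∀ n, Function.Exact (d n) (d (n + 1))) ∧
    Nonempty (↥M ≃ₗ[S] ↥(LinearMap.range (d 0))) ∧
    (∀ (I : Type u) [AddCommGroup I] [Module Sᵐᵒᵖ I], Module.Injective Sᵐᵒᵖ I →
      ∀ n, Function.Exact (NTensor.rmap I (d n)) (NTensor.rmap I (d (n + 1))))

/-- `gflatDimLE S n M` means `Gfd_S(M) ≤ n`: there is an exact sequence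
`0 → G_n → ⋯ → G_0 → M → 0` of left `S`-modules with all `G_i` Gorenstein flat. -/
def gflatDimLE : ℕ → ModuleCat.{u} S → Prop
  | 0, M => IsGorensteinFlat S M
  | n + 1, M => ∃ (K G : ModuleCat.{u} S) (ι : ↥K →ₗ[S] ↥G) (π : ↥G →ₗ[S] ↥M),
      Function.Injective ι ∧ Function.Surjective π ∧ Function.Exact ι π ∧
      IsGorensteinFlat S G ∧ gflatDimLE n K

/-- `flatDimLE S n M` means `fd_S(M) ≤ n`: there is an exact sequence
`0 → F_n → ⋯ → F_0 → M → 0` of left `S`-modules with all `F_i` flat. -/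
def flatDimLE : ℕ → ModuleCat.{u} S → Prop
  | 0, M => IsFlatMod S M
  | n + 1, M => ∃ (K F : ModuleCat.{u} S) (ι : ↥K →ₗ[S] ↥F) (π : ↥F →ₗ[S] ↥M),
      Function.Injective ι ∧ Function.Surjective π ∧ Function.Exact ι π ∧
      IsFlatMod S F ∧ flatDimLE n K

/-- `injDimLE S n M` means `id_S(M) ≤ n`: there is an exact sequence
`0 → M → I^0 → ⋯ → I^n → 0` of left `S`-modules with all `I^i` injective. -/
def injDimLE : ℕ → ModuleCat.{u} S → Prop
  | 0, M => Module.Injective S ↥M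
  | n + 1, M => ∃ (I C : ModuleCat.{u} S) (ι : ↥M →ₗ[S] ↥I) (π : ↥I →ₗ[S] ↥C),
      Function.Injective ι ∧ Function.Surjective π ∧ Function.Exact ι π ∧
      Module.Injective S ↥I ∧ injDimLE n C

/-- The Gorenstein flat dimension `Gfd_S(M) ∈ ℕ∞` of a left `S`-module `M`. -/
noncomputable def gflatDim (M : ModuleCat.{u} S) : ℕ∞ :=
  sInf {d : ℕ∞ | ∃ n : ℕ, d = n ∧ gflatDimLE S n M}

/-- The flat dimension `fd_S(M) ∈ ℕ∞` of a left `S`-module `M`. -/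
noncomputable def flatDim (M : ModuleCat.{u} S) : ℕ∞ :=
  sInf {d : ℕ∞ | ∃ n : ℕ, d = n ∧ flatDimLE S n M}

/-- The injective dimension `id_S(M) ∈ ℕ∞` of a left `S`-module `M`. -/
noncomputable def injDim (M : ModuleCat.{u} S) : ℕ∞ :=
  sInf {d : ℕ∞ | ∃ n : ℕ, d = n ∧ injDimLE S n M}

/-- The left weak Gorenstein global dimension
`l.Gwdim(S) = sup { Gfd_S(M) | M a left S-module }`.  The right weak Gorenstein global
dimension of `S` is `gorensteinWeakGlobalDim Sᵐᵒᵖ`. -/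
noncomputable def gorensteinWeakGlobalDim : ℕ∞ :=
  ⨆ M : ModuleCat.{u} S, gflatDim S M

/-- The left weak global dimension `sup { fd_S(M) | M a left S-module }`.  (By a classical
theorem it agrees with `weakGlobalDim Sᵐᵒᵖ`, and the common value is `wdim S`.) -/
noncomputable def weakGlobalDim : ℕ∞ :=
  ⨆ M : ModuleCat.{u} S, flatDim S M

/-- The left finitistic flat dimension
`l.FFD(S) = sup { fd_S(M) | M a left S-module with fd_S(M) < ∞ }`. -/
noncomputable def finitisticFlatDim : ℕ∞ :=
  sSup {d : ℕ∞ | d ≠ ⊤ ∧ ∃ M : ModuleCat.{u} S, flatDim S M = d}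

/-- The left finitistic Gorenstein flat dimension
`l.FGFD(S) = sup { Gfd_S(M) | M a left S-module with Gfd_S(M) < ∞ }`. -/
noncomputable def finitisticGFlatDim : ℕ∞ :=
  sSup {d : ℕ∞ | d ≠ ⊤ ∧ ∃ M : ModuleCat.{u} S, gflatDim S M = d}

/-- A ring `S` is *left GF-closed* if the class of Gorenstein flat left `S`-modules is closed
under extensions.  `S` is right GF-closed iff `Sᵐᵒᵖ` is left GF-closed, and GF-closed if both. -/
def IsGFClosed : Prop :=
  ∀ (A B C : ModuleCat.{u} S) (f : ↥A →ₗ[S] ↥B) (g : ↥B →ₗ[S] ↥C),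
    Function.Injective f → Function.Surjective g → Function.Exact f g →
      IsGorensteinFlat S A → IsGorensteinFlat S C → IsGorensteinFlat S B

/-- A ring `S` is *left coherent* if every finitely generated left ideal of `S` is finitely
presented (as a left `S`-module).  `S` is right coherent iff `Sᵐᵒᵖ` is left coherent. -/
def IsLeftCoherent : Prop :=
  ∀ I : Submodule S S, I.FG → Module.FinitePresentation S ↥I

/-- A ring `S` is *left IF* if every injective left `S`-module is flat.  `S` is right IF iff
`Sᵐᵒᵖ` is left IF, and IF if both. -/
def IsLeftIF : Prop :=
  ∀ E : ModuleCat.{u} S, Module.Injective S ↥E → IsFlatMod S E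

/-- A ring `S` is *left `n`-IF* if `fd_S(E) ≤ n` for every injective left `S`-module `E`.
`S` is right `n`-IF iff `Sᵐᵒᵖ` is left `n`-IF, and `n`-IF if both. -/
def IsLeftNIF (n : ℕ) : Prop :=
  ∀ E : ModuleCat.{u} S, Module.Injective S ↥E → flatDim S E ≤ (n : ℕ∞)

/-- `Ext¹_S(T, K) = 0`, expressed by its standard characterization: every extension of `T`
by `K` (i.e. every short exact sequence `0 → K → X → T → 0`) splits. -/
def Ext1Zero (T K : ModuleCat.{u} S) : Prop :=
  ∀ (X : ModuleCat.{u} S) (ι : ↥K →ₗ[S] ↥X) (π : ↥X →ₗ[S] ↥T),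
    Function.Injective ι → Function.Surjective π → Function.Exact ι π →
      ∃ ρ : ↥X →ₗ[S] ↥K, ρ.comp ι = LinearMap.id

/-- A left `S`-module `K` is *cotorsion* if `Ext¹_S(F, K) = 0` for every flat left
`S`-module `F`. -/
def IsCotorsion (K : ModuleCat.{u} S) : Prop :=
  ∀ F : ModuleCat.{u} S, IsFlatMod S F → Ext1Zero S F K

/-- `Tor₁^S(A, T) = 0` for a right `S`-module `A` and a left `S`-module `T`, expressed by its
standard characterization: for every short exact sequence `0 → K → F → T → 0` of left
`S`-modules with `F` flat, the induced map `A ⊗_S K → A ⊗_S F` is injective. -/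
def Tor1Zero (A : Type u) [AddCommGroup A] [Module Sᵐᵒᵖ A] (T : ModuleCat.{u} S) : Prop :=
  ∀ (K F : ModuleCat.{u} S) (ι : ↥K →ₗ[S] ↥F) (π : ↥F →ₗ[S] ↥T),
    IsFlatMod S F → Function.Injective ι → Function.Surjective π → Function.Exact ι π →
      Function.Injective (NTensor.rmap A ι)

/-- A left `S`-module is *finitely presented* if it admits a presentation with finitely many
generators and relations. -/
abbrev IsFinitelyPresented (M : ModuleCat.{u} S) : Prop :=
  Module.FinitePresentation S ↥M

end Dims

/-! ### Characters and tensor products -/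

section Characters

/-- A character of an abelian group `G` that vanishes on the kernel of `f : G →+ H` factors
through `f`. -/
theorem exists_character_comp_eq {G H : Type*} [AddCommGroup G] [AddCommGroup H] (f : G →+ H)
    (c : G →+ AddCircle (1 : ℚ)) (hc : ∀ x, f x = 0 → c x = 0) :
    ∃ c' : H →+ AddCircle (1 : ℚ), ∀ x, c' (f x) = c x := by
  have hker : f.ker ≤ c.ker := fun x hx => hc x hx
  obtain ⟨c', hc'⟩ := (Module.Baer.of_divisible (AddCircle (1 : ℚ))).extension_property_addMonoidHom
    (QuotientAddGroup.kerLift f) (QuotientAddGroup.kerLift_injective f)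
    (QuotientAddGroup.lift f.ker c hker)
  exact ⟨c', fun x => DFunLike.congr_fun hc' (x : G ⧸ f.ker)⟩

/-- Characters separate an element of an abelian group from a subgroup not containing it. -/
theorem exists_character_ne_zero {G : Type*} [AddCommGroup G] (H : AddSubgroup G) {x : G}
    (hx : x ∉ H) : ∃ c : G →+ AddCircle (1 : ℚ), (∀ y ∈ H, c y = 0) ∧ c x ≠ 0 := by
  obtain ⟨c, hc⟩ := CharacterModule.exists_character_apply_ne_zero_of_ne_zero
    (A := G ⧸ H) (a := (x : G ⧸ H)) (fun h0 => hx ((QuotientAddGroup.eq_zero_iff x).1 h0))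
  let c' : (G ⧸ H) →+ AddCircle (1 : ℚ) := c
  refine ⟨c'.comp (QuotientAddGroup.mk' H), fun y hy => ?_, hc⟩
  have : ((y : G) : G ⧸ H) = 0 := (QuotientAddGroup.eq_zero_iff y).2 hy
  change c' (y : G ⧸ H) = 0
  rw [this, map_zero]

variable (S : Type u) [Ring S]

/-- The character group `Hom_ℤ(A, ℚ/ℤ)` of a right module `A`. -/
def RightChar (A : Type u) [AddCommGroup A] : Type u := A →+ AddCircle (1 : ℚ)

namespace RightChar

variable {S}
variable {A B : Type u} [AddCommGroup A] [Module Sᵐᵒᵖ A] [AddCommGroup B] [Module Sᵐᵒᵖ B]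
variable {M M' : Type u} [AddCommGroup M] [Module S M] [AddCommGroup M'] [Module S M']

instance : AddCommGroup (RightChar A) := inferInstanceAs (AddCommGroup (A →+ AddCircle (1 : ℚ)))

instance : FunLike (RightChar A) A (AddCircle (1 : ℚ)) :=
  inferInstanceAs (FunLike (A →+ AddCircle (1 : ℚ)) A (AddCircle (1 : ℚ)))

instance : AddMonoidHomClass (RightChar A) A (AddCircle (1 : ℚ)) :=
  inferInstanceAs (AddMonoidHomClass (A →+ AddCircle (1 : ℚ)) A (AddCircle (1 : ℚ)))

@[ext] theorem ext {c c' : RightChar A} (h : ∀ a, c a = c' a) : c = c' := DFunLike.ext _ _ h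

theorem add_apply (c c' : RightChar A) (a : A) : (c + c') a = c a + c' a := rfl

theorem zero_apply (a : A) : (0 : RightChar A) a = 0 := rfl

/-- The left module structure on the character group of a right module. -/
instance : Module S (RightChar A) where
  smul r c := AddMonoidHom.comp c (DistribSMul.toAddMonoidHom A (op r))
  one_smul c := by ext a; exact congrArg c (one_smul Sᵐᵒᵖ a)
  mul_smul r s c := by ext a; exact congrArg c (mul_smul (op s) (op r) a)
  smul_zero r := rfl
  smul_add r c c' := rfl
  add_smul r s c := by
    ext a
    exact (congrArg c (add_smul (op r) (op s) a)).trans (map_add c _ _)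
  zero_smul c := by
    ext a
    exact (congrArg c (zero_smul Sᵐᵒᵖ a)).trans (map_zero c)

theorem smul_apply (r : S) (c : RightChar A) (a : A) : (r • c) a = c (op r • a) := rfl

/-- The contravariant functoriality of the character module. -/
def dual (f : A →ₗ[Sᵐᵒᵖ] B) : RightChar B →ₗ[S] RightChar A where
  toFun c := AddMonoidHom.comp c f.toAddMonoidHom
  map_add' _ _ := rfl
  map_smul' r c := by ext a; exact congrArg c (f.map_smul (op r) a).symm

theorem dual_apply (f : A →ₗ[Sᵐᵒᵖ] B) (c : RightChar B) (a : A) :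
    dual f c a = c (f a) := rfl

theorem dual_injective (f : A →ₗ[Sᵐᵒᵖ] B) (hf : Function.Surjective f) :
    Function.Injective (dual (S := S) f) := by
  intro c c' hcc
  ext b
  obtain ⟨a, rfl⟩ := hf b
  exact DFunLike.congr_fun hcc a

theorem dual_surjective (f : A →ₗ[Sᵐᵒᵖ] B) (hf : Function.Injective f) :
    Function.Surjective (dual (S := S) f) := by
  intro c
  obtain ⟨c', hc'⟩ := exists_character_comp_eq f.toAddMonoidHom c (fun x hx => by
    rw [(map_eq_zero_iff f hf).1 hx]; exact map_zero c)
  exact ⟨c', RightChar.ext hc'⟩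

theorem dual_exact {C : Type u} [AddCommGroup C] [Module Sᵐᵒᵖ C] (f : A →ₗ[Sᵐᵒᵖ] B)
    (g : B →ₗ[Sᵐᵒᵖ] C) (hfg : Function.Exact f g) :
    Function.Exact (dual (S := S) g) (dual (S := S) f) := by
  intro c
  constructor
  · intro hc
    obtain ⟨c', hc'⟩ := exists_character_comp_eq g.toAddMonoidHom c (fun x hx => by
      obtain ⟨a, rfl⟩ := (hfg x).1 hx
      exact DFunLike.congr_fun hc a)
    exact ⟨c', RightChar.ext hc'⟩
  · rintro ⟨c', rfl⟩
    ext a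
    rw [dual_apply, dual_apply, hfg.apply_apply_eq_zero, map_zero, zero_apply]

/-- The class of the pure tensor `a ⊗ m`. -/
def tmul (S : Type u) [Ring S] {A : Type u} [AddCommGroup A] [Module Sᵐᵒᵖ A]
    {M : Type u} [AddCommGroup M] [Module S M] (a : A) (m : M) : NTensor S A M :=
  QuotientAddGroup.mk (FreeAbelianGroup.of (a, m))

theorem tmul_eq_of_mem {x y : FreeAbelianGroup (A × M)} (hxy : x - y ∈ tensorRels S A M) :
    (QuotientAddGroup.mk x : NTensor S A M) = QuotientAddGroup.mk y := by
  rw [← sub_eq_zero]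
  exact (QuotientAddGroup.eq_zero_iff (x - y)).2 hxy

theorem add_tmul (a a' : A) (m : M) : tmul S (a + a') m = tmul S a m + tmul S a' m :=
  tmul_eq_of_mem (S := S) (y := FreeAbelianGroup.of (a, m) + FreeAbelianGroup.of (a', m)) (by
    rw [← sub_sub]
    exact AddSubgroup.subset_closure (Or.inl ⟨a, a', m, rfl⟩))

theorem tmul_add (a : A) (m m' : M) : tmul S a (m + m') = tmul S a m + tmul S a m' :=
  tmul_eq_of_mem (S := S) (y := FreeAbelianGroup.of (a, m) + FreeAbelianGroup.of (a, m')) (by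
    rw [← sub_sub]
    exact AddSubgroup.subset_closure (Or.inr (Or.inl ⟨a, m, m', rfl⟩)))

theorem smul_tmul (r : S) (a : A) (m : M) : tmul S (op r • a) m = tmul S a (r • m) :=
  tmul_eq_of_mem (S := S) (AddSubgroup.subset_closure (Or.inr (Or.inr ⟨a, r, m, rfl⟩)))

theorem tensor_induction {p : NTensor S A M → Prop} (zero : p 0)
    (tmul : ∀ a m, p (tmul S a m)) (neg : ∀ x, p x → p (-x))
    (add : ∀ x y, p x → p y → p (x + y)) (x : NTensor S A M) : p x := by
  obtain ⟨x, rfl⟩ := QuotientAddGroup.mk_surjective x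
  induction x using FreeAbelianGroup.induction_on with
  | zero => exact zero
  | of x => exact tmul x.1 x.2
  | neg x hx => exact neg _ hx
  | add x y hx hy => exact add _ _ hx hy

theorem rmap_tmul (g : M →ₗ[S] M') (a : A) (m : M) :
    NTensor.rmap A g (tmul S a m) = tmul S a (g m) :=
  congrArg (QuotientAddGroup.mk (s := tensorRels S A M'))
    (FreeAbelianGroup.map_of_apply (a, m))

theorem lmap_tmul (f : A →ₗ[Sᵐᵒᵖ] B) (a : A) (m : M) :
    NTensor.lmap M f (tmul S a m) = tmul S (f a) m :=
  congrArg (QuotientAddGroup.mk (s := tensorRels S B M))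
    (FreeAbelianGroup.map_of_apply (a, m))

/-- The homomorphism `M → A⁺` attached to a character of `A ⊗ M`. -/
def curry (c : NTensor S A M →+ AddCircle (1 : ℚ)) : M →ₗ[S] RightChar A where
  toFun m := AddMonoidHom.mk' (fun a => c (tmul S a m))
    (fun a a' => by rw [add_tmul, map_add])
  map_add' m m' := by
    ext a
    exact (congrArg c (tmul_add a m m')).trans (map_add c _ _)
  map_smul' r m := by
    ext a
    exact congrArg c (smul_tmul r a m).symm

theorem curry_apply (c : NTensor S A M →+ AddCircle (1 : ℚ)) (m : M) (a : A) :
    curry c m a = c (tmul S a m) := rfl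

/-- The character of `A ⊗ M` attached to a homomorphism `M → A⁺`. -/
def uncurry (φ : M →ₗ[S] RightChar A) : NTensor S A M →+ AddCircle (1 : ℚ) :=
  QuotientAddGroup.lift (tensorRels S A M) (FreeAbelianGroup.lift fun p => φ p.2 p.1) (by
    refine (AddSubgroup.closure_le _).2 ?_
    rintro x (⟨a₁, a₂, m, rfl⟩ | ⟨a, m₁, m₂, rfl⟩ | ⟨a, r, m, rfl⟩) <;>
      refine SetLike.mem_coe.2 (AddMonoidHom.mem_ker.2 ?_) <;>
      simp [FreeAbelianGroup.lift_apply_of, add_apply, smul_apply])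

theorem uncurry_tmul (φ : M →ₗ[S] RightChar A) (a : A) (m : M) :
    uncurry φ (tmul S a m) = φ m a :=
  FreeAbelianGroup.lift_apply_of _ _

theorem character_ext {c c' : NTensor S A M →+ AddCircle (1 : ℚ)}
    (hcc : ∀ a m, c (tmul S a m) = c' (tmul S a m)) : c = c' := by
  ext x
  induction x using tensor_induction with
  | zero => rw [map_zero, map_zero]
  | tmul a m => exact hcc a m
  | neg x hx => rw [map_neg, map_neg, hx]
  | add x y hx hy => rw [map_add, map_add, hx, hy]

theorem uncurry_comp (φ : M' →ₗ[S] RightChar A) (g : M →ₗ[S] M') (x : NTensor S A M) :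
    uncurry φ (NTensor.rmap A g x) = uncurry (φ.comp g) x :=
  DFunLike.congr_fun (character_ext (c := (uncurry φ).comp (NTensor.rmap A g)) fun a m => by
    rw [AddMonoidHom.comp_apply, rmap_tmul, uncurry_tmul, uncurry_tmul, LinearMap.comp_apply]) x

theorem uncurry_dual_comp (φ : M →ₗ[S] RightChar B) (f : A →ₗ[Sᵐᵒᵖ] B) (x : NTensor S A M) :
    uncurry φ (NTensor.lmap M f x) = uncurry ((dual f).comp φ) x :=
  DFunLike.congr_fun (character_ext (c := (uncurry φ).comp (NTensor.lmap M f)) fun a m => by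
    rw [AddMonoidHom.comp_apply, lmap_tmul, uncurry_tmul, uncurry_tmul, LinearMap.comp_apply,
      dual_apply]) x

theorem uncurry_curry (c : NTensor S A M →+ AddCircle (1 : ℚ)) : uncurry (curry c) = c :=
  character_ext fun a m => by rw [uncurry_tmul, curry_apply]

theorem uncurry_zero : uncurry (0 : M →ₗ[S] RightChar A) = 0 :=
  character_ext fun a m => by rw [uncurry_tmul]; rfl

/-- `A ⊗ -` preserves exactness of `M → M' → M''` iff `Hom(-, A⁺)` does. -/
theorem rmap_exact_iff {M'' : Type u} [AddCommGroup M''] [Module S M''] (f : M →ₗ[S] M')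
    (g : M' →ₗ[S] M'') (hgf : g.comp f = 0) :
    Function.Exact (NTensor.rmap A f) (NTensor.rmap A g) ↔
      ∀ φ : M' →ₗ[S] RightChar A, φ.comp f = 0 → ∃ θ : M'' →ₗ[S] RightChar A, θ.comp g = φ := by
  constructor
  · intro hex φ hφ
    obtain ⟨c, hc⟩ := exists_character_comp_eq (NTensor.rmap A g) (uncurry φ) (fun x hx => by
      obtain ⟨y, rfl⟩ := (hex x).1 hx
      rw [uncurry_comp, hφ, uncurry_zero, AddMonoidHom.zero_apply])
    refine ⟨curry c, ?_⟩
    ext m a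
    rw [LinearMap.comp_apply, curry_apply, ← rmap_tmul, hc, uncurry_tmul]
  · intro hext x
    constructor
    · intro hx
      by_contra hxr
      obtain ⟨c, hc, hcx⟩ := exists_character_ne_zero (NTensor.rmap A f).range (x := x) hxr
      obtain ⟨θ, hθ⟩ := hext (curry c) (by
        ext m a
        rw [LinearMap.comp_apply, curry_apply, ← rmap_tmul]
        exact hc _ ⟨_, rfl⟩)
      apply hcx
      rw [← uncurry_curry c, ← hθ, ← uncurry_comp, hx, map_zero]
    · rintro ⟨y, rfl⟩
      induction y using tensor_induction with
      | zero => rw [map_zero, map_zero]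
      | tmul a m =>
        rw [rmap_tmul, rmap_tmul, ← LinearMap.comp_apply, hgf, LinearMap.zero_apply]
        have h0 := tmul_add (S := S) a (0 : M'') 0
        rw [add_zero] at h0
        exact left_eq_add.1 h0
      | neg x hx => rw [map_neg, map_neg, hx, neg_zero]
      | add x y hx hy => rw [map_add, map_add, hx, hy, add_zero]

/-- `A ⊗ g` is injective iff every homomorphism to `A⁺` extends along `g`. -/
theorem rmap_injective_iff (g : M →ₗ[S] M') :
    Function.Injective (NTensor.rmap A g) ↔
      ∀ φ : M →ₗ[S] RightChar A, ∃ θ : M' →ₗ[S] RightChar A, θ.comp g = φ := by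
  constructor
  · intro hinj φ
    obtain ⟨c, hc⟩ := exists_character_comp_eq (NTensor.rmap A g) (uncurry φ) (fun x hx => by
      rw [(map_eq_zero_iff _ hinj).1 hx, map_zero])
    refine ⟨curry c, ?_⟩
    ext m a
    rw [LinearMap.comp_apply, curry_apply, ← rmap_tmul, hc, uncurry_tmul]
  · intro hext
    rw [injective_iff_map_eq_zero]
    intro x hx
    by_contra hx0
    obtain ⟨c, -, hcx⟩ := exists_character_ne_zero (⊥ : AddSubgroup (NTensor S A M)) (x := x) hx0
    obtain ⟨θ, hθ⟩ := hext (curry c)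
    apply hcx
    rw [← uncurry_curry c, ← hθ, ← uncurry_comp, hx, map_zero]

/-- `f ⊗ M` is injective iff every homomorphism `M → A⁺` lifts along `f⁺ : B⁺ → A⁺`. -/
theorem lmap_injective_iff (f : A →ₗ[Sᵐᵒᵖ] B) :
    Function.Injective (NTensor.lmap M f) ↔
      ∀ φ : M →ₗ[S] RightChar A, ∃ θ : M →ₗ[S] RightChar B, (dual f).comp θ = φ := by
  constructor
  · intro hinj φ
    obtain ⟨c, hc⟩ := exists_character_comp_eq (NTensor.lmap M f) (uncurry φ) (fun x hx => by
      rw [(map_eq_zero_iff _ hinj).1 hx, map_zero])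
    refine ⟨curry c, ?_⟩
    ext m a
    rw [LinearMap.comp_apply, dual_apply, curry_apply, ← lmap_tmul, hc, uncurry_tmul]
  · intro hext
    rw [injective_iff_map_eq_zero]
    intro x hx
    by_contra hx0
    obtain ⟨c, -, hcx⟩ := exists_character_ne_zero (⊥ : AddSubgroup (NTensor S A M)) (x := x) hx0
    obtain ⟨θ, hθ⟩ := hext (curry c)
    apply hcx
    rw [← uncurry_curry c, ← hθ, ← uncurry_dual_comp, hx, map_zero]

/-- If `A ⊗ I → A ⊗ S` is injective for every finitely generated left ideal `I`, then it is
injective for every left ideal. -/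
theorem rmap_subtype_injective_of_fg
    (hfg : ∀ I : Submodule S S, I.FG → Function.Injective (NTensor.rmap A I.subtype))
    (I : Submodule S S) : Function.Injective (NTensor.rmap A I.subtype) := by
  have key (x : NTensor S A I) : ∃ (J : Submodule S S) (hJ : J ≤ I), J.FG ∧
      ∃ y : NTensor S A J, NTensor.rmap A (Submodule.inclusion hJ) y = x := by
    have comp_apply {J K L : Submodule S S} (hJ : J ≤ K) (hK : K ≤ L) (y : NTensor S A J) :
        NTensor.rmap A (Submodule.inclusion hK) (NTensor.rmap A (Submodule.inclusion hJ) y) =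
          NTensor.rmap A (Submodule.inclusion (hJ.trans hK)) y := by
      induction y using tensor_induction with
      | zero => simp only [map_zero]
      | tmul a m => simp only [rmap_tmul]; rfl
      | neg x hx => simp only [map_neg, hx]
      | add x y hx hy => simp only [map_add, hx, hy]
    induction x using tensor_induction with
    | zero => exact ⟨⊥, bot_le, Submodule.fg_bot, 0, map_zero _⟩
    | tmul a m =>
      refine ⟨Submodule.span S {(m : S)}, ?_, Submodule.fg_span_singleton _,
        tmul S a ⟨m, Submodule.mem_span_singleton_self _⟩, ?_⟩
      · exact (Submodule.span_singleton_le_iff_mem _ _).2 m.2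
      · rw [rmap_tmul]; rfl
    | neg x hx =>
      obtain ⟨J, hJ, hJfg, y, rfl⟩ := hx
      exact ⟨J, hJ, hJfg, -y, map_neg _ _⟩
    | add x x' hx hx' =>
      obtain ⟨J, hJ, hJfg, y, rfl⟩ := hx
      obtain ⟨J', hJ', hJfg', y', rfl⟩ := hx'
      refine ⟨J ⊔ J', sup_le hJ hJ', hJfg.sup hJfg',
        NTensor.rmap A (Submodule.inclusion le_sup_left) y +
          NTensor.rmap A (Submodule.inclusion le_sup_right) y', ?_⟩
      rw [map_add, comp_apply, comp_apply]
  rw [injective_iff_map_eq_zero]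
  intro x hx
  obtain ⟨J, hJ, hJfg, y, rfl⟩ := key x
  have hy : NTensor.rmap A J.subtype y = 0 := by
    rw [← hx]
    clear hx
    induction y using tensor_induction with
    | zero => simp only [map_zero]
    | tmul a m => simp only [rmap_tmul]; rfl
    | neg x hx => simp only [map_neg, hx]
    | add x y hx hy => simp only [map_add, hx, hy]
  rw [(map_eq_zero_iff _ (hfg J hJfg)).1 hy, map_zero]

/-- The character module of a free right module is an injective left module. -/
theorem injective_free (X : Type u) : Module.Injective S (RightChar (X →₀ Sᵐᵒᵖ)) where
  out := by
    intro P Q _ _ _ _ f hf φ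
    let φ' (x : X) : P →+ AddCircle (1 : ℚ) :=
      AddMonoidHom.mk' (fun p => φ p (Finsupp.single x 1)) (fun p q => by rw [map_add]; rfl)
    have hφ' (x : X) := exists_character_comp_eq f.toAddMonoidHom (φ' x) (fun p hp => by
      rw [(map_eq_zero_iff f hf).1 hp, map_zero])
    choose ψ hψ using hφ'
    let Ψ (q : Q) : (X →₀ Sᵐᵒᵖ) →+ AddCircle (1 : ℚ) :=
      Finsupp.liftAddHom fun x => AddMonoidHom.mk' (fun r => ψ x (unop r • q)) (fun r s => by
        rw [unop_add, add_smul, map_add])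
    have hΨ (q : Q) (x : X) (r : Sᵐᵒᵖ) : Ψ q (Finsupp.single x r) = ψ x (unop r • q) :=
      Finsupp.liftAddHom_apply_single _ _ _
    refine ⟨{ toFun := Ψ, map_add' := fun q q' => ?_, map_smul' := fun s q => ?_ }, fun p => ?_⟩
    · refine Finsupp.addHom_ext (f := Ψ (q + q')) (g := Ψ q + Ψ q') fun x r => ?_
      rw [AddMonoidHom.add_apply, hΨ, hΨ, hΨ, smul_add, map_add]
    · refine Finsupp.addHom_ext (f := Ψ (s • q))
        (g := AddMonoidHom.comp (Ψ q) (DistribSMul.toAddMonoidHom _ (op s))) fun x r => ?_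
      rw [AddMonoidHom.comp_apply, DistribSMul.toAddMonoidHom_apply, Finsupp.smul_single, hΨ, hΨ,
        smul_smul]
      rfl
    · refine Finsupp.addHom_ext (f := Ψ (f p)) (g := (φ p : _ →+ AddCircle (1 : ℚ)))
        fun x r => ?_
      rw [hΨ, ← f.map_smul]
      refine (hψ x _).trans ?_
      change φ (unop r • p) (Finsupp.single x 1) = φ p (Finsupp.single x r)
      rw [map_smul, smul_apply, Finsupp.smul_single]
      simp

end RightChar

end Characters

/-! ### Short exact sequences and vanishing of `Ext` -/

section ShortExactSequences

variable {S : Type u} [Ring S]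

/-- `0 → K → F → M → 0` is exact. -/
structure IsShortExact {K F M : ModuleCat.{u} S} (ι : ↥K →ₗ[S] ↥F) (π : ↥F →ₗ[S] ↥M) : Prop where
  injective : Function.Injective ι
  surjective : Function.Surjective π
  exact : Function.Exact ι π

/-- `Extⁱ(M, N) = 0`. -/
def ExtZero (i : ℕ) (M N : ModuleCat.{u} S) : Prop :=
  ∀ x : CategoryTheory.Abelian.Ext M N i, x = 0

namespace IsShortExact

variable {K F M N : ModuleCat.{u} S} {ι : ↥K →ₗ[S] ↥F} {π : ↥F →ₗ[S] ↥M}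

theorem comp_eq_zero (hs : IsShortExact ι π) : π.comp ι = 0 :=
  LinearMap.ext fun x => hs.exact.apply_apply_eq_zero x

/-- The short complex in `ModuleCat S` given by a short exact sequence. -/
abbrev shortComplex (hs : IsShortExact ι π) : CategoryTheory.ShortComplex (ModuleCat.{u} S) :=
  CategoryTheory.ShortComplex.mk (ModuleCat.ofHom ι) (ModuleCat.ofHom π) (by
    rw [← ModuleCat.ofHom_comp, hs.comp_eq_zero]; rfl)

theorem shortExact (hs : IsShortExact ι π) : hs.shortComplex.ShortExact where
  exact := (CategoryTheory.ShortComplex.ShortExact.moduleCat_exact_iff_function_exact _).2 hs.exact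
  mono_f := (ModuleCat.mono_iff_injective _).2 hs.injective
  epi_g := (ModuleCat.epi_iff_surjective _).2 hs.surjective

open CategoryTheory.Abelian in
theorem extZero_left (hs : IsShortExact ι π) {i : ℕ} (hF : ExtZero i F N)
    (hM : ExtZero (i + 1) M N) : ExtZero i K N := by
  intro x
  obtain ⟨y, rfl⟩ := Ext.contravariant_sequence_exact₁ hs.shortExact N x (n₁ := i + 1)
    (add_comm 1 i) (hM _)
  rw [show y = 0 from hF y, Ext.comp_zero]

open CategoryTheory.Abelian in
theorem extZero_middle (hs : IsShortExact ι π) {i : ℕ} (hK : ExtZero i K N)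
    (hM : ExtZero i M N) : ExtZero i F N := by
  intro x
  obtain ⟨y, rfl⟩ := Ext.contravariant_sequence_exact₂ hs.shortExact N x (hK _)
  rw [show y = 0 from hM y, Ext.comp_zero]

open CategoryTheory.Abelian in
theorem extZero_right (hs : IsShortExact ι π) {i : ℕ} (hK : ExtZero i K N)
    (hF : ExtZero (i + 1) F N) : ExtZero (i + 1) M N := by
  intro x
  obtain ⟨y, rfl⟩ := Ext.contravariant_sequence_exact₃ hs.shortExact N x (hF _) (n₀ := i)
    (add_comm 1 i)
  rw [show y = 0 from hK y, Ext.comp_zero]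

open CategoryTheory.Abelian in
theorem exists_extension (hs : IsShortExact ι π) (hM : ExtZero 1 M N) (φ : ↥K →ₗ[S] ↥N) :
    ∃ θ : ↥F →ₗ[S] ↥N, θ.comp ι = φ := by
  obtain ⟨y, hy⟩ := Ext.contravariant_sequence_exact₁ hs.shortExact N
    (Ext.mk₀ (ModuleCat.ofHom φ)) (n₁ := 1) rfl (hM _)
  obtain ⟨g, rfl⟩ := (Ext.mk₀_bijective _ _).2 y
  rw [Ext.mk₀_comp_mk₀] at hy
  exact ⟨g.hom, congrArg ModuleCat.Hom.hom ((Ext.mk₀_bijective _ _).1 hy)⟩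

open CategoryTheory.Abelian in
theorem extZero_one_of_exists_extension (hs : IsShortExact ι π) (hF : ExtZero 1 F N)
    (hext : ∀ φ : ↥K →ₗ[S] ↥N, ∃ θ : ↥F →ₗ[S] ↥N, θ.comp ι = φ) : ExtZero 1 M N := by
  intro x
  obtain ⟨y, rfl⟩ := Ext.contravariant_sequence_exact₃ hs.shortExact N x (hF _) (n₀ := 0) rfl
  obtain ⟨φ, rfl⟩ := (Ext.mk₀_bijective _ _).2 y
  obtain ⟨θ, hθ⟩ := hext φ.hom
  have hφ : φ = CategoryTheory.CategoryStruct.comp hs.shortComplex.f (ModuleCat.ofHom θ) := ModuleCat.hom_ext hθ.symm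
  rw [hφ, ← Ext.mk₀_comp_mk₀, hs.shortExact.extClass_comp_assoc]

open CategoryTheory.Abelian in
theorem exists_lift (hs : IsShortExact ι π) (hK : ExtZero 1 N K) (φ : ↥N →ₗ[S] ↥M) :
    ∃ θ : ↥N →ₗ[S] ↥F, π.comp θ = φ := by
  obtain ⟨y, hy⟩ := Ext.covariant_sequence_exact₃ N hs.shortExact
    (Ext.mk₀ (ModuleCat.ofHom φ)) (n₁ := 1) rfl (hK _)
  obtain ⟨g, rfl⟩ := (Ext.mk₀_bijective _ _).2 y
  rw [Ext.mk₀_comp_mk₀] at hy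
  exact ⟨g.hom, congrArg ModuleCat.Hom.hom ((Ext.mk₀_bijective _ _).1 hy)⟩

open CategoryTheory.Abelian in
theorem extZero_one_of_exists_lift (hs : IsShortExact ι π) (hF : ExtZero 1 N F)
    (hlift : ∀ φ : ↥N →ₗ[S] ↥M, ∃ θ : ↥N →ₗ[S] ↥F, π.comp θ = φ) : ExtZero 1 N K := by
  intro x
  obtain ⟨y, rfl⟩ := Ext.covariant_sequence_exact₁ N hs.shortExact x (hF _) (n₀ := 0) rfl
  obtain ⟨φ, rfl⟩ := (Ext.mk₀_bijective _ _).2 y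
  obtain ⟨θ, hθ⟩ := hlift φ.hom
  have hφ : φ = CategoryTheory.CategoryStruct.comp (ModuleCat.ofHom θ) hs.shortComplex.g := ModuleCat.hom_ext hθ.symm
  rw [hφ, ← Ext.mk₀_comp_mk₀, Ext.comp_assoc_of_second_deg_zero, hs.shortExact.comp_extClass,
    Ext.comp_zero]

open CategoryTheory.Abelian in
theorem extZero_succ_of_target (hs : IsShortExact ι π) {i : ℕ} (hM : ExtZero i N M)
    (hF : ExtZero (i + 1) N F) : ExtZero (i + 1) N K := by
  intro x
  obtain ⟨y, rfl⟩ := Ext.covariant_sequence_exact₁ N hs.shortExact x (hF _) (n₀ := i) rfl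
  rw [show y = 0 from hM y, Ext.zero_comp]

open CategoryTheory.Abelian in
theorem extZero_of_succ_target (hs : IsShortExact ι π) {i : ℕ} (hK : ExtZero (i + 1) N K)
    (hF : ExtZero i N F) : ExtZero i N M := by
  intro x
  obtain ⟨y, rfl⟩ := Ext.covariant_sequence_exact₃ N hs.shortExact x (n₁ := i + 1) rfl (hK _)
  rw [show y = 0 from hF y, Ext.zero_comp]

theorem exists_desc (hs : IsShortExact ι π) (φ : ↥F →ₗ[S] ↥N) (hφ : φ.comp ι = 0) :
    ∃ θ : ↥M →ₗ[S] ↥N, θ.comp π = φ := by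
  have hker : LinearMap.ker π ≤ LinearMap.ker φ := by
    intro x hx
    obtain ⟨k, rfl⟩ := (hs.exact x).1 hx
    exact DFunLike.congr_fun hφ k
  refine ⟨((LinearMap.ker π).liftQ φ hker).comp
    (π.quotKerEquivOfSurjective hs.surjective).symm.toLinearMap, ?_⟩
  ext x
  have : (π.quotKerEquivOfSurjective hs.surjective).symm (π x) = Submodule.Quotient.mk x := by
    rw [LinearEquiv.symm_apply_eq]; rfl
  simp [this]

variable {A B C F' A' D' D : ModuleCat.{u} S}

/-- The pushout of two short exact sequences with the same left end. -/
theorem exists_pushout {f : ↥A →ₗ[S] ↥B} {g : ↥B →ₗ[S] ↥C} {j : ↥A →ₗ[S] ↥F}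
    {p : ↥F →ₗ[S] ↥A'} (hfg : IsShortExact f g) (hjp : IsShortExact j p) :
    ∃ (D : ModuleCat.{u} S) (b : ↥B →ₗ[S] ↥D) (q : ↥D →ₗ[S] ↥A') (e : ↥F →ₗ[S] ↥D)
      (r : ↥D →ₗ[S] ↥C), IsShortExact b q ∧ IsShortExact e r := by
  let W : Submodule S (B × F) := LinearMap.range (f.prod (-j))
  have memW (x : B × F) : x ∈ W ↔ ∃ a, f a = x.1 ∧ -j a = x.2 := by
    constructor
    · rintro ⟨a, rfl⟩; exact ⟨a, rfl, rfl⟩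
    · rintro ⟨a, h₁, h₂⟩; exact ⟨a, Prod.ext h₁ h₂⟩
  let D := ModuleCat.of S ((B × F) ⧸ W)
  have hq : W ≤ LinearMap.ker (p.comp (LinearMap.snd S B F)) := by
    intro x hx
    obtain ⟨a, -, h₂⟩ := (memW x).1 hx
    rw [LinearMap.mem_ker, LinearMap.comp_apply, LinearMap.snd_apply, ← h₂, map_neg,
      hjp.exact.apply_apply_eq_zero, neg_zero]
  have hr : W ≤ LinearMap.ker (g.comp (LinearMap.fst S B F)) := by
    intro x hx
    obtain ⟨a, h₁, -⟩ := (memW x).1 hx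
    rw [LinearMap.mem_ker, LinearMap.comp_apply, LinearMap.fst_apply, ← h₁,
      hfg.exact.apply_apply_eq_zero]
  refine ⟨D, W.mkQ.comp (LinearMap.inl S B F), W.liftQ _ hq, W.mkQ.comp (LinearMap.inr S B F),
    W.liftQ _ hr, ⟨?_, ?_, ?_⟩, ⟨?_, ?_, ?_⟩⟩
  · rw [injective_iff_map_eq_zero]
    intro x hx
    obtain ⟨a, h₁, h₂⟩ := (memW _).1 ((Submodule.Quotient.mk_eq_zero W).1 hx)
    have ha : a = 0 := (map_eq_zero_iff j hjp.injective).1 (neg_eq_zero.1 h₂)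
    have h₁ : f a = x := h₁
    rw [← h₁, ha, map_zero]
  · intro y
    obtain ⟨x, rfl⟩ := hjp.surjective y
    exact ⟨W.mkQ (0, x), rfl⟩
  · intro y
    obtain ⟨⟨b, x⟩, rfl⟩ := W.mkQ_surjective y
    constructor
    · intro hx
      obtain ⟨a, rfl⟩ := (hjp.exact x).1 hx
      refine ⟨b + f a, ?_⟩
      refine (Submodule.Quotient.eq W).2 ((memW _).2 ⟨a, ?_, ?_⟩) <;> simp
    · rintro ⟨b', hb'⟩
      rw [← hb']
      exact map_zero p
  · rw [injective_iff_map_eq_zero]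
    intro x hx
    obtain ⟨a, h₁, h₂⟩ := (memW _).1 ((Submodule.Quotient.mk_eq_zero W).1 hx)
    have ha : a = 0 := (map_eq_zero_iff f hfg.injective).1 h₁
    have h₂ : -j a = x := h₂
    rw [← h₂, ha, map_zero, neg_zero]
  · intro y
    obtain ⟨x, rfl⟩ := hfg.surjective y
    exact ⟨W.mkQ (x, 0), rfl⟩
  · intro y
    obtain ⟨⟨b, x⟩, rfl⟩ := W.mkQ_surjective y
    constructor
    · intro hx
      obtain ⟨a, rfl⟩ := (hfg.exact b).1 hx
      refine ⟨x + j a, ?_⟩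
      refine (Submodule.Quotient.eq W).2 ((memW _).2 ⟨-a, ?_, ?_⟩) <;> simp
    · rintro ⟨b', hb'⟩
      rw [← hb']
      exact map_zero g

/-- For `F ⊆ D ⊆ F'` with `D / F = C` and `F' / D = D'`, the quotient `F' / F` is an extension of
`D'` by `C`. -/
theorem exists_quotient {i : ↥F →ₗ[S] ↥D} {q : ↥D →ₗ[S] ↥C} {e : ↥D →ₗ[S] ↥F'}
    {r : ↥F' →ₗ[S] ↥D'} (hiq : IsShortExact i q) (her : IsShortExact e r) :
    ∃ (Q : ModuleCat.{u} S) (t : ↥F' →ₗ[S] ↥Q) (v : ↥C →ₗ[S] ↥Q) (w : ↥Q →ₗ[S] ↥D'),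
      IsShortExact (e.comp i) t ∧ IsShortExact v w := by
  let W : Submodule S F' := LinearMap.range (e.comp i)
  let Q := ModuleCat.of S (F' ⧸ W)
  let t : ↥F' →ₗ[S] ↥Q := W.mkQ
  have ht0 (x : F') : t x = 0 ↔ ∃ y, e (i y) = x := Submodule.Quotient.mk_eq_zero W
  have ht : IsShortExact (e.comp i) t :=
    ⟨her.injective.comp hiq.injective, W.mkQ_surjective, fun x => ht0 x⟩
  obtain ⟨v, hv⟩ := hiq.exists_desc (t.comp e) (by
    ext x
    exact (ht0 _).2 ⟨x, rfl⟩)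
  obtain ⟨w, hw⟩ := ht.exists_desc r (by
    ext x
    exact her.exact.apply_apply_eq_zero _)
  have hv (x) : v (q x) = t (e x) := DFunLike.congr_fun hv x
  have hw (x) : w (t x) = r x := DFunLike.congr_fun hw x
  refine ⟨Q, t, v, w, ht, ?_, ?_, ?_⟩
  · rw [injective_iff_map_eq_zero]
    intro c hc
    obtain ⟨x, rfl⟩ := hiq.surjective c
    rw [hv, ht0] at hc
    obtain ⟨y, hy⟩ := hc
    rw [← her.injective hy, hiq.exact.apply_apply_eq_zero]
  · intro y
    obtain ⟨x, rfl⟩ := her.surjective y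
    exact ⟨t x, hw x⟩
  · intro y
    obtain ⟨x, rfl⟩ := ht.surjective y
    rw [hw]
    constructor
    · intro hx
      obtain ⟨z, rfl⟩ := (her.exact x).1 hx
      exact ⟨q z, hv z⟩
    · rintro ⟨c, hc⟩
      obtain ⟨z, rfl⟩ := hiq.surjective c
      rw [hv] at hc
      rw [← hw, ← hc, hw, her.exact.apply_apply_eq_zero]

end IsShortExact

theorem extZero_of_projective (P N : ModuleCat.{u} S) [Module.Projective S P] (i : ℕ) :
    ExtZero (i + 1) P N := by
  have : CategoryTheory.Projective P := (IsProjective.iff_projective P).1 inferInstance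
  exact fun x => CategoryTheory.Abelian.Ext.eq_zero_of_projective x

theorem extZero_of_injective (M J : ModuleCat.{u} S) (hJ : Module.Injective S J) (i : ℕ) :
    ExtZero (i + 1) M J := by
  have : CategoryTheory.Injective J := Module.injective_object_of_injective_module S J
  exact fun x => CategoryTheory.Abelian.Ext.eq_zero_of_injective x

theorem extZero_of_subsingleton (M N : ModuleCat.{u} S) [Subsingleton M] (i : ℕ) :
    ExtZero i M N := by
  have h0 : CategoryTheory.Limits.IsZero M := ModuleCat.isZero_of_subsingleton M
  intro x
  rw [← CategoryTheory.Abelian.Ext.mk₀_id_comp x, h0.eq_of_src (CategoryTheory.CategoryStruct.id M) 0,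
    CategoryTheory.Abelian.Ext.mk₀_zero, CategoryTheory.Abelian.Ext.zero_comp]

theorem exists_free_cover (M : ModuleCat.{u} S) :
    ∃ (K P : ModuleCat.{u} S) (ι : ↥K →ₗ[S] ↥P) (π : ↥P →ₗ[S] ↥M),
      Module.Projective S P ∧ IsShortExact ι π := by
  let π : (M →₀ S) →ₗ[S] M := Finsupp.linearCombination S id
  refine ⟨ModuleCat.of S (LinearMap.ker π), ModuleCat.of S (M →₀ S), (LinearMap.ker π).subtype, π,
    inferInstanceAs (Module.Projective S (M →₀ S)), Subtype.val_injective, ?_, ?_⟩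
  · exact Finsupp.linearCombination_id_surjective S M
  · exact LinearMap.exact_subtype_ker_map π

/-- The module of characters of a right module, as an object of `ModuleCat S`. -/
abbrev charMod (S : Type u) [Ring S] (A : Type u) [AddCommGroup A] [Module Sᵐᵒᵖ A] :
    ModuleCat.{u} S :=
  ModuleCat.of S (RightChar A)

section

variable (A : Type u) [AddCommGroup A] [Module Sᵐᵒᵖ A]

theorem isShortExact_dual {A B C : Type u} [AddCommGroup A] [Module Sᵐᵒᵖ A] [AddCommGroup B]
    [Module Sᵐᵒᵖ B] [AddCommGroup C] [Module Sᵐᵒᵖ C] (f : A →ₗ[Sᵐᵒᵖ] B) (g : B →ₗ[Sᵐᵒᵖ] C)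
    (hf : Function.Injective f) (hg : Function.Surjective g) (hfg : Function.Exact f g) :
    IsShortExact (K := charMod S C) (F := charMod S B) (M := charMod S A)
      (RightChar.dual g) (RightChar.dual f) :=
  ⟨RightChar.dual_injective g hg, RightChar.dual_surjective f hf, RightChar.dual_exact f g hfg⟩

/-- Every character module `A⁺` has a cosyzygy of the form `K⁺`: for `P → A` a free cover with kernel
`K`, the sequence `0 → A⁺ → P⁺ → K⁺ → 0` is exact with `P⁺` injective. -/
theorem exists_charMod_cosyzygy :
    ∃ (K P : ModuleCat.{u} Sᵐᵒᵖ) (f : ↥K →ₗ[Sᵐᵒᵖ] ↥P) (g : ↥P →ₗ[Sᵐᵒᵖ] A),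
      Function.Injective f ∧ Module.Injective S (RightChar P) ∧
      IsShortExact (K := charMod S A) (F := charMod S P) (M := charMod S K)
        (RightChar.dual g) (RightChar.dual f) := by
  let g : (A →₀ Sᵐᵒᵖ) →ₗ[Sᵐᵒᵖ] A := Finsupp.linearCombination Sᵐᵒᵖ id
  refine ⟨ModuleCat.of _ (LinearMap.ker g), ModuleCat.of _ (A →₀ Sᵐᵒᵖ), (LinearMap.ker g).subtype,
    g, Subtype.val_injective, RightChar.injective_free A, ?_⟩
  exact isShortExact_dual _ _ Subtype.val_injective
    (Finsupp.linearCombination_id_surjective _ A) (LinearMap.exact_subtype_ker_map g)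

/-- `Extⁱ⁺¹(M, A⁺)` vanishes for all `M` as soon as it vanishes for `M = S / I` with `I` a finitely
generated left ideal. -/
theorem extZero_charMod_of_fg (i : ℕ) : ∀ (A : Type u) [AddCommGroup A] [Module Sᵐᵒᵖ A],
    (∀ I : Submodule S S, I.FG → ExtZero (i + 1) (ModuleCat.of S (S ⧸ I)) (charMod S A)) →
      ∀ M, ExtZero (i + 1) M (charMod S A) := by
  induction i with
  | zero =>
    intro A _ _ hA M
    refine extZero_of_injective M _ (Module.Baer.injective ?_) 0
    have hfg (I : Submodule S S) (hI : I.FG) : Function.Injective (NTensor.rmap A I.subtype) := by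
      rw [RightChar.rmap_injective_iff]
      have hs : IsShortExact (K := ModuleCat.of S I) (F := ModuleCat.of S S)
          (M := ModuleCat.of S (S ⧸ I)) I.subtype I.mkQ :=
        ⟨Subtype.val_injective, I.mkQ_surjective, LinearMap.exact_subtype_mkQ I⟩
      exact fun φ => hs.exists_extension (N := charMod S A) (hA I hI) φ
    intro I φ
    obtain ⟨θ, hθ⟩ := (RightChar.rmap_injective_iff I.subtype).1
      (RightChar.rmap_subtype_injective_of_fg hfg I) φ
    exact ⟨θ, fun x hx => DFunLike.congr_fun hθ ⟨x, hx⟩⟩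
  | succ i ih =>
    intro A _ _ hA M
    obtain ⟨K, P, f, g, -, hP, hs⟩ := exists_charMod_cosyzygy (S := S) A
    refine hs.extZero_succ_of_target (ih K (fun I hI => ?_) M) (extZero_of_injective _ _ hP _)
    exact hs.extZero_of_succ_target (hA I hI) (extZero_of_injective _ _ hP _)

end

/-- Flatness is the vanishing of `Ext¹` into all character modules. -/
theorem isFlatMod_iff (M : ModuleCat.{u} S) :
    IsFlatMod S M ↔
      ∀ (A : Type u) [AddCommGroup A] [Module Sᵐᵒᵖ A], ExtZero 1 M (charMod S A) := by
  constructor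
  · intro hM A _ _
    obtain ⟨K, P, f, g, hf, hP, hs⟩ := exists_charMod_cosyzygy (S := S) A
    exact hs.extZero_one_of_exists_lift (extZero_of_injective _ _ hP _)
      ((RightChar.lmap_injective_iff f).1 (hM K P f hf))
  · intro hM A B _ _ _ _ f hf
    rw [RightChar.lmap_injective_iff]
    have hs := isShortExact_dual (S := S) f (LinearMap.range f).mkQ hf
      (Submodule.mkQ_surjective _) (LinearMap.exact_map_mkQ_range f)
    exact fun φ => hs.exists_lift (N := M) (hM _) φ

theorem IsFlatMod.extZero {M : ModuleCat.{u} S} (hM : IsFlatMod S M) (i : ℕ) :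
    ∀ (A : Type u) [AddCommGroup A] [Module Sᵐᵒᵖ A], ExtZero (i + 1) M (charMod S A) := by
  induction i with
  | zero => exact (isFlatMod_iff M).1 hM
  | succ i ih =>
    intro A _ _
    obtain ⟨K, P, f, g, -, hP, hs⟩ := exists_charMod_cosyzygy (S := S) A
    exact hs.extZero_succ_of_target (ih K) (extZero_of_injective _ _ hP _)

theorem IsFlatMod.of_projective (P : ModuleCat.{u} S) [Module.Projective S P] : IsFlatMod S P :=
  (isFlatMod_iff P).2 fun _ _ _ => extZero_of_projective P _ 0

theorem IsFlatMod.of_subsingleton (M : ModuleCat.{u} S) [Subsingleton M] : IsFlatMod S M :=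
  (isFlatMod_iff M).2 fun _ _ _ => extZero_of_subsingleton M _ 1

end ShortExactSequences

/-! ### Gorenstein flat modules via characters of injective right modules -/

section GorensteinFlat

variable {S : Type u} [Ring S]

/-- `Extⁱ(M, E⁺) = 0` for all `i > n` and all injective right modules `E`; equivalently,
`Tor_i(E, M) = 0` for all such `i` and `E`. -/
def TorVanishAbove (n : ℕ) (M : ModuleCat.{u} S) : Prop :=
  ∀ (E : Type u) [AddCommGroup E] [Module Sᵐᵒᵖ E], Module.Injective Sᵐᵒᵖ E →
    ∀ i, n < i → ExtZero i M (charMod S E)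

theorem IsFlatMod.torVanishAbove {M : ModuleCat.{u} S} (hM : IsFlatMod S M) (n : ℕ) :
    TorVanishAbove n M := by
  intro E _ _ _ i hi
  obtain ⟨i, rfl⟩ := Nat.exists_eq_succ_of_ne_zero (by lia : i ≠ 0)
  exact hM.extZero i E

theorem TorVanishAbove.mono {M : ModuleCat.{u} S} {m n : ℕ} (hM : TorVanishAbove m M)
    (hmn : m ≤ n) : TorVanishAbove n M :=
  fun E _ _ hE i hi => hM E hE i (by lia)

namespace IsShortExact

variable {K F M : ModuleCat.{u} S} {ι : ↥K →ₗ[S] ↥F} {π : ↥F →ₗ[S] ↥M}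

theorem torVanishAbove_left_of_succ (hs : IsShortExact ι π) {n : ℕ} (hF : TorVanishAbove n F)
    (hM : TorVanishAbove (n + 1) M) : TorVanishAbove n K :=
  fun E _ _ hE i hi => hs.extZero_left (hF E hE i hi) (hM E hE (i + 1) (by lia))

theorem torVanishAbove_right (hs : IsShortExact ι π) {n : ℕ} (hK : TorVanishAbove n K)
    (hF : TorVanishAbove (n + 1) F) : TorVanishAbove (n + 1) M := by
  intro E _ _ hE i hi
  obtain ⟨i, rfl⟩ := Nat.exists_eq_succ_of_ne_zero (by lia : i ≠ 0)
  exact hs.extZero_right (hK E hE i (by lia)) (hF E hE (i + 1) hi)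

end IsShortExact

/-- `M` has a coresolution `0 → M → F⁰ → F¹ → ⋯` by flat modules such that `M` and all its
cosyzygies `N` satisfy `Tor_i(E, N) = 0` for `i > 0` and `E` injective.  The cosyzygies are packaged
as a class `C` of modules that is closed under forming a further step. -/
def HasAcyclicFlatCoresolution (M : ModuleCat.{u} S) : Prop :=
  ∃ C : ModuleCat.{u} S → Prop, C M ∧ ∀ N, C N → TorVanishAbove 0 N ∧
    ∃ (F N' : ModuleCat.{u} S) (ι : ↥N →ₗ[S] ↥F) (π : ↥F →ₗ[S] ↥N'),
      IsShortExact ι π ∧ IsFlatMod S F ∧ C N'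

namespace HasAcyclicFlatCoresolution

variable {M : ModuleCat.{u} S}

theorem torVanishAbove (hM : HasAcyclicFlatCoresolution M) : TorVanishAbove 0 M := by
  obtain ⟨C, hC, hstep⟩ := hM
  exact (hstep M hC).1

theorem exists_step (hM : HasAcyclicFlatCoresolution M) :
    ∃ (F N : ModuleCat.{u} S) (ι : ↥M →ₗ[S] ↥F) (π : ↥F →ₗ[S] ↥N),
      IsShortExact ι π ∧ IsFlatMod S F ∧ HasAcyclicFlatCoresolution N := by
  obtain ⟨C, hC, hstep⟩ := hM
  obtain ⟨-, F, N, ι, π, hs, hF, hN⟩ := hstep M hC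
  exact ⟨F, N, ι, π, hs, hF, C, hN, hstep⟩

theorem of_step {F N : ModuleCat.{u} S} {ι : ↥M →ₗ[S] ↥F} {π : ↥F →ₗ[S] ↥N}
    (hs : IsShortExact ι π) (hF : IsFlatMod S F) (hN : HasAcyclicFlatCoresolution N)
    (hM : TorVanishAbove 0 M) : HasAcyclicFlatCoresolution M := by
  obtain ⟨C, hC, hstep⟩ := hN
  refine ⟨fun X => X = M ∨ C X, Or.inl rfl, ?_⟩
  rintro X (rfl | hX)
  · exact ⟨hM, F, N, ι, π, hs, hF, Or.inr hC⟩
  · obtain ⟨hX0, F, N, ι, π, hs, hF, hN⟩ := hstep X hX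
    exact ⟨hX0, F, N, ι, π, hs, hF, Or.inr hN⟩

theorem exists_syzygy (hM : HasAcyclicFlatCoresolution M) :
    ∃ (K F : ModuleCat.{u} S) (ι : ↥K →ₗ[S] ↥F) (π : ↥F →ₗ[S] ↥M),
      IsShortExact ι π ∧ IsFlatMod S F ∧ HasAcyclicFlatCoresolution K := by
  obtain ⟨K, P, ι, π, _, hs⟩ := exists_free_cover M
  have hP := IsFlatMod.of_projective P
  exact ⟨K, P, ι, π, hs, hP, of_step hs hP hM (hs.torVanishAbove_left_of_succ
    (hP.torVanishAbove 0) (hM.torVanishAbove.mono zero_le_one))⟩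

end HasAcyclicFlatCoresolution

/-- A relation that is total in both directions on `p` admits `ℤ`-indexed chains through any
point of `p`, in any prescribed degree. -/
theorem exists_int_chain {α : Type*} {p : α → Prop} {r : α → α → Prop}
    (hnext : ∀ a, p a → ∃ b, p b ∧ r a b) (hprev : ∀ a, p a → ∃ b, p b ∧ r b a) (a : α) (ha : p a)
    (k₀ : ℤ) : ∃ f : ℤ → α, f k₀ = a ∧ ∀ k, p (f k) ∧ r (f k) (f (k + 1)) := by
  choose next hnext using fun x : {x // p x} => hnext x.1 x.2
  choose prev hprev using fun x : {x // p x} => hprev x.1 x.2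
  let next' (x : {x // p x}) : {x // p x} := ⟨next x, (hnext x).1⟩
  let prev' (x : {x // p x}) : {x // p x} := ⟨prev x, (hprev x).1⟩
  let f : ℤ → {x // p x}
    | Int.ofNat n => next'^[n] ⟨a, ha⟩
    | Int.negSucc n => prev'^[n + 1] ⟨a, ha⟩
  suffices hf : ∀ k, r (f k) (f (k + 1)) by
    refine ⟨fun k => f (k - k₀), ?_, fun k => ⟨(f _).2, ?_⟩⟩
    · beta_reduce; rw [sub_self]; rfl
    · beta_reduce; rw [add_sub_right_comm]; exact hf _
  intro k
  match k with
  | Int.ofNat n =>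
    change r (next'^[n] ⟨a, ha⟩) (next'^[n + 1] ⟨a, ha⟩)
    rw [Function.iterate_succ_apply']
    exact (hnext _).2
  | Int.negSucc 0 => exact (hprev ⟨a, ha⟩).2
  | Int.negSucc (n + 1) =>
    change r (prev'^[n + 1 + 1] ⟨a, ha⟩) (prev'^[n + 1] ⟨a, ha⟩)
    rw [Function.iterate_succ_apply' prev' (n + 1)]
    exact (hprev _).2

theorem HasAcyclicFlatCoresolution.isGorensteinFlat {M : ModuleCat.{u} S}
    (hM : HasAcyclicFlatCoresolution M) : IsGorensteinFlat S M := by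
  obtain ⟨N, rfl, hN⟩ := exists_int_chain (p := HasAcyclicFlatCoresolution (S := S))
    (r := fun X Y => ∃ (F : ModuleCat.{u} S) (ι : ↥X →ₗ[S] ↥F) (π : ↥F →ₗ[S] ↥Y),
      IsShortExact ι π ∧ IsFlatMod S F)
    (fun X hX => by
      obtain ⟨F, Y, ι, π, hs, hF, hY⟩ := hX.exists_step
      exact ⟨Y, hY, F, ι, π, hs, hF⟩)
    (fun X hX => by
      obtain ⟨Y, F, ι, π, hs, hF, hY⟩ := hX.exists_syzygy
      exact ⟨Y, hY, F, ι, π, hs, hF⟩) M hM (0 + 1)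
  choose hN F ι π hs hF using hN
  let d (k : ℤ) : ↥(F k) →ₗ[S] ↥(F (k + 1)) := (ι (k + 1)).comp (π k)
  have hd (k : ℤ) : Function.Exact (d k) (d (k + 1)) := by
    intro x
    constructor
    · intro hx
      obtain ⟨y, rfl⟩ := ((hs (k + 1)).exact x).1
        ((map_eq_zero_iff _ (hs (k + 1 + 1)).injective).1 hx)
      obtain ⟨z, rfl⟩ := (hs k).surjective y
      exact ⟨z, rfl⟩
    · rintro ⟨y, rfl⟩
      change ι (k + 1 + 1) (π (k + 1) (ι (k + 1) (π k y))) = 0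
      rw [(hs (k + 1)).exact.apply_apply_eq_zero, map_zero]
  have hrange : LinearMap.range (d 0) = LinearMap.range (ι (0 + 1)) :=
    LinearMap.range_comp_of_range_eq_top _ (LinearMap.range_eq_top.2 (hs 0).surjective)
  refine ⟨F, d, hF, hd, ?_, ?_⟩
  · rw [hrange]
    exact ⟨LinearEquiv.ofInjective (ι (0 + 1)) (hs _).injective⟩
  · intro E _ _ hE k
    rw [RightChar.rmap_exact_iff _ _ (hd k).linearMap_comp_eq_zero]
    intro φ hφ
    obtain ⟨θ, hθ⟩ := (hs (k + 1)).exists_desc (N := charMod S E) φ (by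
      refine LinearMap.ext fun y => ?_
      obtain ⟨z, rfl⟩ := (hs k).surjective y
      exact DFunLike.congr_fun hφ z)
    obtain ⟨θ', hθ'⟩ := (hs (k + 1 + 1)).exists_extension (N := charMod S E)
      ((hN (k + 1 + 1 + 1)).torVanishAbove E hE 1 zero_lt_one) θ
    refine ⟨θ', ?_⟩
    change (θ'.comp (ι (k + 1 + 1))).comp (π (k + 1)) = φ
    rw [hθ', hθ]

theorem IsGorensteinFlat.hasAcyclicFlatCoresolution {M : ModuleCat.{u} S}
    (hM : IsGorensteinFlat S M) : HasAcyclicFlatCoresolution M := by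
  obtain ⟨F, d, hF, hd, ⟨e⟩, hE⟩ := hM
  let Z (k : ℤ) : ModuleCat.{u} S := ModuleCat.of S (LinearMap.range (d k))
  have hs (k : ℤ) : IsShortExact (K := Z k) (F := F (k + 1)) (M := Z (k + 1))
      (LinearMap.range (d k)).subtype (d (k + 1)).rangeRestrict := by
    refine ⟨Subtype.val_injective, LinearMap.surjective_rangeRestrict _, fun x => ?_⟩
    rw [← Subtype.coe_inj]
    exact (hd k x).trans ⟨fun ⟨y, hy⟩ => ⟨⟨x, y, hy⟩, rfl⟩, fun ⟨y, hy⟩ => hy ▸ y.2⟩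
  have hZ (k : ℤ) : TorVanishAbove 0 (Z k) := by
    intro E _ _ hEinj i hi
    obtain ⟨i, rfl⟩ := Nat.exists_eq_succ_of_ne_zero hi.ne'
    induction i generalizing k with
    | zero =>
      obtain ⟨k, rfl⟩ : ∃ k', k = k' + 1 + 1 := ⟨k - 2, by lia⟩
      refine (hs (k + 1)).extZero_one_of_exists_extension ((hF _).extZero 0 E) fun φ => ?_
      obtain ⟨θ, hθ⟩ := (RightChar.rmap_exact_iff (d k) (d (k + 1))
        (hd k).linearMap_comp_eq_zero).1 (hE E hEinj k)
        (φ.comp (d (k + 1)).rangeRestrict) (by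
          ext1 x
          have : (d (k + 1)).rangeRestrict (d k x) = 0 :=
            Subtype.ext ((hd k).apply_apply_eq_zero x)
          change φ ((d (k + 1)).rangeRestrict (d k x)) = 0
          rw [this, map_zero])
      refine ⟨θ, LinearMap.ext fun y => ?_⟩
      obtain ⟨x, rfl⟩ := LinearMap.surjective_rangeRestrict (d (k + 1)) y
      exact DFunLike.congr_fun hθ x
    | succ i ih =>
      obtain ⟨k, rfl⟩ : ∃ k', k = k' + 1 := ⟨k - 1, by lia⟩
      exact (hs k).extZero_right (ih k (Nat.succ_pos i)) ((hF _).extZero (i + 1) E)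
  refine ⟨fun N => ∃ (k : ℤ) (ι : ↥N →ₗ[S] ↥(F (k + 1))) (π : ↥(F (k + 1)) →ₗ[S] ↥(Z (k + 1))),
    IsShortExact ι π, ⟨0, (LinearMap.range (d 0)).subtype.comp e.toLinearMap, _,
      (hs 0).injective.comp e.injective, (hs 0).surjective, fun x => ?_⟩, ?_⟩
  · rw [(hs 0).exact x]
    exact ⟨fun ⟨y, hy⟩ => ⟨e.symm y, by
      rw [LinearMap.comp_apply, LinearEquiv.coe_coe, e.apply_symm_apply]; exact hy⟩, fun ⟨y, hy⟩ => ⟨e y, hy⟩⟩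
  · rintro N ⟨k, ι, π, hN⟩
    exact ⟨hN.torVanishAbove_left_of_succ ((hF _).torVanishAbove 0)
      ((hZ _).mono zero_le_one), _, _, ι, π, hN, hF _, k + 1, _, _, hs (k + 1)⟩

theorem IsFlatMod.isGorensteinFlat {M : ModuleCat.{u} S} (hM : IsFlatMod S M) :
    IsGorensteinFlat S M := by
  refine HasAcyclicFlatCoresolution.isGorensteinFlat ⟨fun N => IsFlatMod S N, hM, fun N hN => ?_⟩
  refine ⟨hN.torVanishAbove 0, N, ModuleCat.of S PUnit, LinearMap.id, 0,
    ⟨Function.injective_id, fun y => ⟨0, Subsingleton.elim _ _⟩, fun x => ?_⟩, hN,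
    IsFlatMod.of_subsingleton _⟩
  exact ⟨fun _ => ⟨x, rfl⟩, fun _ => rfl⟩

theorem exists_injective_embedding (A : Type u) [AddCommGroup A] [Module S A] :
    ∃ (E : ModuleCat.{u} S) (f : A →ₗ[S] E), Module.Injective S E ∧ Function.Injective f := by
  let A' := ModuleCat.of S A
  have : CategoryTheory.Injective
      (ModuleCat.of S (CategoryTheory.Injective.under A' : ModuleCat.{u} S)) :=
    CategoryTheory.Injective.injective_under A'
  refine ⟨CategoryTheory.Injective.under A', (CategoryTheory.Injective.ι A').hom,
    Module.injective_module_of_injective_object S _, ?_⟩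
  exact (ModuleCat.mono_iff_injective (CategoryTheory.Injective.ι A')).1 inferInstance

/-- If `0 → F → F' → Q → 0` is exact with `F`, `F'` flat and `Tor₁(E, Q) = 0` for all injective `E`,
then `Q` is flat. -/
theorem IsShortExact.isFlatMod_right {F F' Q : ModuleCat.{u} S} {ι : ↥F →ₗ[S] ↥F'}
    {π : ↥F' →ₗ[S] ↥Q} (hs : IsShortExact ι π) (hF : IsFlatMod S F) (hF' : IsFlatMod S F')
    (hQ : TorVanishAbove 0 Q) : IsFlatMod S Q := by
  rw [isFlatMod_iff]
  intro A _ _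
  refine hs.extZero_one_of_exists_extension (hF'.extZero 0 A) fun φ => ?_
  obtain ⟨E, f, hE, hf⟩ := exists_injective_embedding (S := Sᵐᵒᵖ) A
  obtain ⟨ψ, rfl⟩ := (RightChar.lmap_injective_iff f).1 (hF A E f hf) φ
  obtain ⟨θ, rfl⟩ := hs.exists_extension (N := charMod S E) (hQ E hE 1 zero_lt_one) ψ
  exact ⟨(RightChar.dual f).comp θ, rfl⟩

/-- Over a left GF-closed ring, the cokernel of a monomorphism of Gorenstein flat modules is
Gorenstein flat as soon as it is `Tor`-acyclic against injectives. -/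
theorem IsGFClosed.isGorensteinFlat_right (h : IsGFClosed S) {A B C : ModuleCat.{u} S}
    {f : ↥A →ₗ[S] ↥B} {g : ↥B →ₗ[S] ↥C} (hs : IsShortExact f g) (hA : IsGorensteinFlat S A)
    (hB : IsGorensteinFlat S B) (hC : TorVanishAbove 0 C) : IsGorensteinFlat S C := by
  obtain ⟨F, A', j, p, hjp, hF, hA'⟩ := hA.hasAcyclicFlatCoresolution.exists_step
  obtain ⟨D, b, q, e, r, hbq, her⟩ := hs.exists_pushout hjp
  have hD : IsGorensteinFlat S D :=
    h B D A' b q hbq.injective hbq.surjective hbq.exact hB hA'.isGorensteinFlat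
  obtain ⟨F', D', j', p', hjp', hF', hD'⟩ := hD.hasAcyclicFlatCoresolution.exists_step
  obtain ⟨Q, t, v, w, ht, hvw⟩ := her.exists_quotient hjp'
  have hQ : IsFlatMod S Q := ht.isFlatMod_right hF hF' fun E _ _ hE i hi =>
    hvw.extZero_middle (hC E hE i hi) (hD'.torVanishAbove E hE i hi)
  exact (HasAcyclicFlatCoresolution.of_step hvw hQ hD' hC).isGorensteinFlat

theorem torVanishAbove_of_gflatDimLE {n : ℕ} {M : ModuleCat.{u} S} (hM : gflatDimLE S n M) :
    TorVanishAbove n M := by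
  induction n generalizing M with
  | zero => exact (IsGorensteinFlat.hasAcyclicFlatCoresolution hM).torVanishAbove
  | succ n ih =>
    obtain ⟨K, G, ι, π, hι, hπ, hιπ, hG, hK⟩ := hM
    exact IsShortExact.torVanishAbove_right ⟨hι, hπ, hιπ⟩ (ih hK)
      (hG.hasAcyclicFlatCoresolution.torVanishAbove.mono (Nat.zero_le _))

theorem IsGFClosed.isGorensteinFlat_of_torVanishAbove (h : IsGFClosed S) {m : ℕ}
    {M : ModuleCat.{u} S} (hM : gflatDimLE S m M) (hM0 : TorVanishAbove 0 M) :
    IsGorensteinFlat S M := by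
  induction m generalizing M with
  | zero => exact hM
  | succ m ih =>
    obtain ⟨K, G, ι, π, hι, hπ, hιπ, hG, hK⟩ := hM
    have hs : IsShortExact ι π := ⟨hι, hπ, hιπ⟩
    have hK0 : TorVanishAbove 0 K := hs.torVanishAbove_left_of_succ
      hG.hasAcyclicFlatCoresolution.torVanishAbove (hM0.mono zero_le_one)
    exact h.isGorensteinFlat_right hs (ih hK hK0) hG hM0

/-- If every module has finite Gorenstein flat dimension over a left GF-closed ring, this dimension
is detected by `Tor` against injectives. -/
theorem IsGFClosed.gflatDimLE_of_torVanishAbove (h : IsGFClosed S)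
    (hfin : ∀ M : ModuleCat.{u} S, ∃ m, gflatDimLE S m M) {n : ℕ} {M : ModuleCat.{u} S}
    (hM : TorVanishAbove n M) : gflatDimLE S n M := by
  induction n generalizing M with
  | zero => exact (hfin M).elim fun _ hm => h.isGorensteinFlat_of_torVanishAbove hm hM
  | succ n ih =>
    obtain ⟨K, P, ι, π, _, hs⟩ := exists_free_cover M
    have hP := IsFlatMod.of_projective P
    exact ⟨K, P, ι, π, hs.injective, hs.surjective, hs.exact, hP.isGorensteinFlat,
      ih (hs.torVanishAbove_left_of_succ (hP.torVanishAbove n) hM)⟩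

theorem gflatDim_le_of_gflatDimLE {n : ℕ} {M : ModuleCat.{u} S} (hM : gflatDimLE S n M) :
    gflatDim S M ≤ n :=
  sInf_le ⟨n, rfl, hM⟩

theorem exists_gflatDimLE_of_gflatDim_ne_top {M : ModuleCat.{u} S} (hM : gflatDim S M ≠ ⊤) :
    ∃ m : ℕ, gflatDim S M = m ∧ gflatDimLE S m M := by
  have hne : {d : ℕ∞ | ∃ n : ℕ, d = n ∧ gflatDimLE S n M}.Nonempty := by
    by_contra hempty
    rw [Set.not_nonempty_iff_eq_empty] at hempty
    exact hM (by rw [gflatDim, hempty, sInf_empty])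
  exact csInf_mem hne

end GorensteinFlat

/-- **Lemma 2.4 (1 ⇔ 3).**  If `R` is a left GF-closed ring with `l.Gwdim(R) < ∞` and `n` is a
positive integer, then `l.Gwdim(R) ≤ n` iff `Gfd_R(R/I) ≤ n` for every finitely generated left
ideal `I` of `R`. -/
theorem gorensteinWeakGlobalDim_le_iff_gflatDim_quotient_le (R : Type u) [Ring R]
    (h : IsGFClosed R) (hfin : gorensteinWeakGlobalDim R ≠ ⊤) (n : ℕ) (hn : 0 < n) :
    gorensteinWeakGlobalDim R ≤ (n : ℕ∞) ↔
      ∀ I : Submodule R R, I.FG → gflatDim R (ModuleCat.of R (R ⧸ I)) ≤ (n : ℕ∞) := by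
  refine ⟨fun hle I _ => (le_iSup (gflatDim R) _).trans hle, fun hI => iSup_le fun M => ?_⟩
  have hfinite (M : ModuleCat.{u} R) : ∃ m, gflatDimLE R m M := by
    obtain ⟨m, -, hm⟩ := exists_gflatDimLE_of_gflatDim_ne_top (M := M)
      (ne_top_of_le_ne_top hfin (le_iSup (gflatDim R) M))
    exact ⟨m, hm⟩
  refine gflatDim_le_of_gflatDimLE (h.gflatDimLE_of_torVanishAbove hfinite ?_)
  intro E _ _ hE i hi
  obtain ⟨i, rfl⟩ := Nat.exists_eq_succ_of_ne_zero (by lia : i ≠ 0)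
  refine extZero_charMod_of_fg i E (fun I hIfg => ?_) M
  obtain ⟨m, hm, hmI⟩ := exists_gflatDimLE_of_gflatDim_ne_top
    (ne_top_of_le_ne_top (ENat.natCast_ne_top n) (hI I hIfg))
  have hmn : m ≤ n := by
    have := hI I hIfg
    rw [hm] at this
    exact_mod_cast this
  exact torVanishAbove_of_gflatDimLE hmI E hE (i + 1) (by lia)
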